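/- For any invertible n×n matrices φ, g, h over A and all τ₀, τ₁, τ₂ ∈ Der: p₃(g·φ·h⁻¹)(τ₀,τ₁,τ₂) = p₃(φ)(τ₀,τ₁,τ₂) + p₃(g)(τ₀,τ₁,τ₂) − p₃(h)(τ₀,τ₁,τ₂) + [τ₀(Q(φ;g,h)(τ₁,τ₂)) − τ₁(Q(φ;g,h)(τ₀,τ₂)) + τ₂(Q(φ;g,h)(τ₀,τ₁)) − Q(φ;g,h)(⁅τ₀,τ₁⁆,τ₂) + Q(φ;g,h)(⁅τ₀,τ₂⁆,τ₁) − Q(φ;g,h)(⁅τ₁,τ₂⁆,τ₀)]. (Section 3.5: the gauge-transformation identity p₃(ᵍφ) = p₃(φ) + d_Čech p₃(g) + d_DR p₂(φ,g), with the de Rham differential given by the Chevalley–Eilenberg formula.) -/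

import Mathlib

noncomputable section

variable (k A : Type*) [Field k] [CharZero k] [CommRing A] [Algebra k A]

/-- Entrywise application of a derivation to a matrix. -/
def dmat {n : ℕ} (τ : Derivation k A A) (φ : Matrix (Fin n) (Fin n) A) :
    Matrix (Fin n) (Fin n) A :=
  Matrix.of fun p q => τ (φ p q)

/-- One half, as an element of `A`. -/
def half : A := algebraMap k A 2⁻¹

/-- `P₂(φ,ψ)(τ,σ) := ½[tr(ψ⁻¹φ⁻¹τ(φ)σ(ψ)) − tr(ψ⁻¹φ⁻¹σ(φ)τ(ψ))]`,
the 2-form `½ tr{ψ⁻¹φ⁻¹ dφ dψ}` evaluated on `(τ,σ)`. -/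
def P2 {n : ℕ} (φ ψ : Matrix (Fin n) (Fin n) A) (τ σ : Derivation k A A) : A :=
  half k A * (Matrix.trace (ψ⁻¹ * φ⁻¹ * dmat k A τ φ * dmat k A σ ψ)
    - Matrix.trace (ψ⁻¹ * φ⁻¹ * dmat k A σ φ * dmat k A τ ψ))

/-- `p₃(φ)(τ₁,τ₂,τ₃) := (1/6)·Σ_{π∈S₃} sgn(π)·tr(N_{π(1)} N_{π(2)} N_{π(3)})`
with `N_i = φ⁻¹·τ_i(φ)`; the 3-form `(1/6)tr{(φ⁻¹dφ)³}` evaluated on `(τ₁,τ₂,τ₃)`. -/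
def p3 {n : ℕ} (φ : Matrix (Fin n) (Fin n) A) (τ₁ τ₂ τ₃ : Derivation k A A) : A :=
  algebraMap k A 6⁻¹ *
    ∑ π : Equiv.Perm (Fin 3), (Equiv.Perm.sign π : ℤ) •
      Matrix.trace ((φ⁻¹ * dmat k A (![τ₁, τ₂, τ₃] (π 0)) φ) *
        (φ⁻¹ * dmat k A (![τ₁, τ₂, τ₃] (π 1)) φ) *
        (φ⁻¹ * dmat k A (![τ₁, τ₂, τ₃] (π 2)) φ))

/-- The cochain `p₂(φ,g)` of Section 3.5 (with `g = g_i`, `h = g_j`), evaluated on `(τ,σ)`. -/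
def Qc {n : ℕ} (φ g h : Matrix (Fin n) (Fin n) A) (τ σ : Derivation k A A) : A :=
  half k A * (Matrix.trace (φ⁻¹ * g⁻¹ * dmat k A τ g * φ * h⁻¹ * dmat k A σ h)
    - Matrix.trace (φ⁻¹ * g⁻¹ * dmat k A σ g * φ * h⁻¹ * dmat k A τ h)
    + Matrix.trace (φ⁻¹ * dmat k A τ φ * h⁻¹ * dmat k A σ h)
    - Matrix.trace (φ⁻¹ * dmat k A σ φ * h⁻¹ * dmat k A τ h)
    - Matrix.trace (g⁻¹ * dmat k A τ g * dmat k A σ φ * φ⁻¹)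
    + Matrix.trace (g⁻¹ * dmat k A σ g * dmat k A τ φ * φ⁻¹))

section Lemmas

open Matrix

variable {k A : Type*} [Field k] [CommRing A] [Algebra k A] {n : ℕ}

lemma dmat_mul (τ : Derivation k A A) (M N : Matrix (Fin n) (Fin n) A) :
    dmat k A τ (M * N) = dmat k A τ M * N + M * dmat k A τ N := by
  ext i j
  simp only [dmat, of_apply, mul_apply, Matrix.add_apply, map_sum, Derivation.leibniz, smul_eq_mul,
    Finset.sum_add_distrib]
  rw [add_comm]
  simp only [mul_comm]

lemma dmat_one (τ : Derivation k A A) : dmat k A τ (1 : Matrix (Fin n) (Fin n) A) = 0 := by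
  ext i j
  by_cases hij : i = j <;> simp [dmat, one_apply, hij]

lemma dmat_nonsing_inv (τ : Derivation k A A) {M : Matrix (Fin n) (Fin n) A} (hM : IsUnit M) :
    dmat k A τ M⁻¹ = -(M⁻¹ * dmat k A τ M * M⁻¹) := by
  have hdet := (isUnit_iff_isUnit_det M).1 hM
  have h₁ := dmat_mul τ M⁻¹ M
  rw [nonsing_inv_mul M hdet, dmat_one] at h₁
  calc dmat k A τ M⁻¹ = dmat k A τ M⁻¹ * M * M⁻¹ := by
        rw [mul_assoc, mul_nonsing_inv M hdet, mul_one]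
    _ = _ := by rw [eq_neg_of_add_eq_zero_left h₁.symm, neg_mul]

lemma dmat_lie (σ τ : Derivation k A A) (M : Matrix (Fin n) (Fin n) A) :
    dmat k A ⁅σ, τ⁆ M = dmat k A σ (dmat k A τ M) - dmat k A τ (dmat k A σ M) := by
  ext i j
  simp [dmat, Derivation.commutator_apply]

lemma derivation_trace (τ : Derivation k A A) (M : Matrix (Fin n) (Fin n) A) :
    τ (trace M) = trace (dmat k A τ M) := by
  simp [trace, dmat]

/-- The exterior derivative `dU(σ,τ) = σ(U(τ)) - τ(U(σ)) - U(⁅σ,τ⁆)` of a matrix-valued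
1-cochain. -/
def matrixExtDeriv (U : Derivation k A A → Matrix (Fin n) (Fin n) A) (σ τ : Derivation k A A) :
    Matrix (Fin n) (Fin n) A :=
  dmat k A σ (U τ) - dmat k A τ (U σ) - U ⁅σ, τ⁆

/-- The 2-cochain `tr (U ∧ V)` of two matrix-valued 1-cochains. -/
def traceWedge (U V : Derivation k A A → Matrix (Fin n) (Fin n) A) (σ τ : Derivation k A A) : A :=
  trace (U σ * V τ) - trace (U τ * V σ)

/-- The Chevalley–Eilenberg differential of a 2-cochain. -/
def extDerivTwo (ω : Derivation k A A → Derivation k A A → A) (τ₀ τ₁ τ₂ : Derivation k A A) : A :=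
  τ₀ (ω τ₁ τ₂) - τ₁ (ω τ₀ τ₂) + τ₂ (ω τ₀ τ₁) - ω ⁅τ₀, τ₁⁆ τ₂ + ω ⁅τ₀, τ₂⁆ τ₁ - ω ⁅τ₁, τ₂⁆ τ₀

/-- The Leibniz rule `d tr(U ∧ V) = tr(dU ∧ V) - tr(U ∧ dV)`. -/
lemma extDerivTwo_traceWedge (U V : Derivation k A A → Matrix (Fin n) (Fin n) A)
    (τ₀ τ₁ τ₂ : Derivation k A A) :
    extDerivTwo (traceWedge U V) τ₀ τ₁ τ₂ =
      trace (matrixExtDeriv U τ₀ τ₁ * V τ₂) - trace (matrixExtDeriv U τ₀ τ₂ * V τ₁)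
        + trace (matrixExtDeriv U τ₁ τ₂ * V τ₀) - trace (U τ₀ * matrixExtDeriv V τ₁ τ₂)
        + trace (U τ₁ * matrixExtDeriv V τ₀ τ₂) - trace (U τ₂ * matrixExtDeriv V τ₀ τ₁) := by
  simp only [extDerivTwo, traceWedge, matrixExtDeriv, map_sub, derivation_trace, dmat_mul, sub_mul,
    mul_sub, trace_add, trace_sub]
  ring

/-- The matrix-valued 1-cochain `M⁻¹ dM`. -/
def logDerivForm (M : Matrix (Fin n) (Fin n) A) (τ : Derivation k A A) : Matrix (Fin n) (Fin n) A :=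
  M⁻¹ * dmat k A τ M

/-- The Maurer–Cartan equation for `M⁻¹ dM`. -/
lemma matrixExtDeriv_logDerivForm {M : Matrix (Fin n) (Fin n) A} (hM : IsUnit M)
    (σ τ : Derivation k A A) :
    matrixExtDeriv (logDerivForm M) σ τ =
      logDerivForm M τ * logDerivForm M σ - logDerivForm M σ * logDerivForm M τ := by
  simp only [matrixExtDeriv, logDerivForm, dmat_mul, dmat_nonsing_inv _ hM, dmat_lie]
  noncomm_ring

lemma dmat_conj {M : Matrix (Fin n) (Fin n) A} (hM : IsUnit M) (τ : Derivation k A A)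
    (N : Matrix (Fin n) (Fin n) A) :
    dmat k A τ (M⁻¹ * N * M) = M⁻¹ * dmat k A τ N * M
      + (M⁻¹ * N * M) * logDerivForm M τ - logDerivForm M τ * (M⁻¹ * N * M) := by
  have hM' : M * M⁻¹ = 1 := mul_nonsing_inv M ((isUnit_iff_isUnit_det M).1 hM)
  have h₁ : (M⁻¹ * N * M) * logDerivForm M τ = M⁻¹ * N * dmat k A τ M := by
    rw [logDerivForm, ← mul_assoc, mul_assoc _ M, hM', mul_one]
  rw [h₁]
  simp only [logDerivForm, dmat_mul, dmat_nonsing_inv _ hM]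
  noncomm_ring

/-- The exterior derivative of the conjugate `M⁻¹ U M`. -/
lemma matrixExtDeriv_conj {M : Matrix (Fin n) (Fin n) A} (hM : IsUnit M)
    (U : Derivation k A A → Matrix (Fin n) (Fin n) A) (σ τ : Derivation k A A) :
    matrixExtDeriv (fun ρ => M⁻¹ * U ρ * M) σ τ =
      M⁻¹ * matrixExtDeriv U σ τ * M
        + (M⁻¹ * U τ * M) * logDerivForm M σ - logDerivForm M σ * (M⁻¹ * U τ * M)
        - (M⁻¹ * U σ * M) * logDerivForm M τ + logDerivForm M τ * (M⁻¹ * U σ * M) := by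
  simp only [matrixExtDeriv, dmat_conj hM, mul_sub, sub_mul]
  abel

lemma conj_mul_conj {M : Matrix (Fin n) (Fin n) A} (hM : IsUnit M)
    (N P : Matrix (Fin n) (Fin n) A) :
    (M⁻¹ * N * M) * (M⁻¹ * P * M) = M⁻¹ * (N * P) * M := by
  have hM' : M * M⁻¹ = 1 := mul_nonsing_inv M ((isUnit_iff_isUnit_det M).1 hM)
  calc _ = M⁻¹ * N * (M * M⁻¹) * P * M := by noncomm_ring
    _ = _ := by rw [hM']; noncomm_ring

lemma trace_conj {M : Matrix (Fin n) (Fin n) A} (hM : IsUnit M) (N : Matrix (Fin n) (Fin n) A) :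
    trace (M⁻¹ * N * M) = trace N := by
  rw [trace_mul_comm, ← mul_assoc, mul_nonsing_inv M ((isUnit_iff_isUnit_det M).1 hM), one_mul]

/-- The logarithmic derivative of the gauge transform `g φ h⁻¹`, conjugated by `h`. -/
lemma logDerivForm_gauge {φ g h : Matrix (Fin n) (Fin n) A} (hφ : IsUnit φ) (hg : IsUnit g)
    (hh : IsUnit h) (τ : Derivation k A A) :
    h⁻¹ * logDerivForm (g * φ * h⁻¹) τ * h =
      φ⁻¹ * logDerivForm g τ * φ + logDerivForm φ τ - logDerivForm h τ := by
  have h₁ : φ⁻¹ * φ = 1 := nonsing_inv_mul φ ((isUnit_iff_isUnit_det φ).1 hφ)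
  have h₂ : g⁻¹ * g = 1 := nonsing_inv_mul g ((isUnit_iff_isUnit_det g).1 hg)
  have h₃ : h⁻¹ * h = 1 := nonsing_inv_mul h ((isUnit_iff_isUnit_det h).1 hh)
  simp only [logDerivForm, Matrix.mul_inv_rev, dmat_mul, dmat_nonsing_inv _ hh,
    nonsing_inv_nonsing_inv h ((isUnit_iff_isUnit_det h).1 hh)]
  calc _ = (h⁻¹ * h) * φ⁻¹ * g⁻¹ * dmat k A τ g * φ * (h⁻¹ * h)
        + (h⁻¹ * h) * φ⁻¹ * (g⁻¹ * g) * dmat k A τ φ * (h⁻¹ * h)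
        - (h⁻¹ * h) * (φ⁻¹ * ((g⁻¹ * g) * φ)) * h⁻¹ * dmat k A τ h * (h⁻¹ * h) := by noncomm_ring
    _ = _ := by simp only [h₁, h₂, h₃, one_mul, mul_one, mul_assoc]

lemma sum_sign_smul_perm_fin_three {B : Type*} [AddCommGroup B] (f : Fin 3 → Fin 3 → Fin 3 → B) :
    ∑ π : Equiv.Perm (Fin 3), (Equiv.Perm.sign π : ℤ) • f (π 0) (π 1) (π 2) =
      f 0 1 2 - f 0 2 1 - f 1 0 2 + f 1 2 0 + f 2 0 1 - f 2 1 0 := by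
  have huniv : (Finset.univ : Finset (Equiv.Perm (Fin 3))) =
      {1, Equiv.swap 1 2, Equiv.swap 0 1, Equiv.swap 0 1 * Equiv.swap 1 2,
        Equiv.swap 1 2 * Equiv.swap 0 1, Equiv.swap 0 2} := by decide
  rw [huniv]
  repeat rw [Finset.sum_insert (by decide)]
  rw [Finset.sum_singleton]
  simp [Equiv.swap_apply_def]
  abel

lemma p3_eq [CharZero k] (M : Matrix (Fin n) (Fin n) A) (τ₀ τ₁ τ₂ : Derivation k A A) :
    p3 k A M τ₀ τ₁ τ₂ = half k A *
      (trace (logDerivForm M τ₀ * logDerivForm M τ₁ * logDerivForm M τ₂)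
        - trace (logDerivForm M τ₀ * logDerivForm M τ₂ * logDerivForm M τ₁)) := by
  have hhalf : half k A = algebraMap k A 6⁻¹ * 3 := by
    rw [half, show (2⁻¹ : k) = 6⁻¹ * 3 by norm_num, map_mul, map_ofNat]
  rw [hhalf, p3]
  have h₁ := trace_mul_cycle (logDerivForm M τ₀) (logDerivForm M τ₁) (logDerivForm M τ₂)
  have h₂ := trace_mul_cycle (logDerivForm M τ₁) (logDerivForm M τ₂) (logDerivForm M τ₀)
  have h₃ := trace_mul_cycle (logDerivForm M τ₀) (logDerivForm M τ₂) (logDerivForm M τ₁)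
  have h₄ := trace_mul_cycle (logDerivForm M τ₂) (logDerivForm M τ₁) (logDerivForm M τ₀)
  rw [sum_sign_smul_perm_fin_three (fun i j l => trace ((M⁻¹ * dmat k A (![τ₀, τ₁, τ₂] i) M) *
    (M⁻¹ * dmat k A (![τ₀, τ₁, τ₂] j) M) * (M⁻¹ * dmat k A (![τ₀, τ₁, τ₂] l) M)))]
  simp only [← logDerivForm.eq_1, cons_val]
  linear_combination algebraMap k A 6⁻¹ * (h₂ - h₁ + h₃ - h₄)

lemma Qc_eq {φ : Matrix (Fin n) (Fin n) A} (hφ : IsUnit φ) (g h : Matrix (Fin n) (Fin n) A)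
    (σ τ : Derivation k A A) :
    Qc k A φ g h σ τ = half k A *
      (traceWedge (fun ρ => φ⁻¹ * logDerivForm g ρ * φ) (logDerivForm h) σ τ
        + traceWedge (logDerivForm φ) (logDerivForm h) σ τ
        - traceWedge (fun ρ => φ⁻¹ * logDerivForm g ρ * φ) (logDerivForm φ) σ τ) := by
  have hφ' : φ * φ⁻¹ = 1 := mul_nonsing_inv φ ((isUnit_iff_isUnit_det φ).1 hφ)
  have key (α β : Derivation k A A) :
      trace (φ⁻¹ * (g⁻¹ * dmat k A α g) * φ * (φ⁻¹ * dmat k A β φ)) =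
        trace (g⁻¹ * dmat k A α g * dmat k A β φ * φ⁻¹) := by
    rw [← mul_assoc _ φ⁻¹, mul_assoc _ φ, hφ', mul_one, mul_assoc φ⁻¹, trace_mul_comm]
  simp only [Qc, traceWedge, logDerivForm, key]
  simp only [← mul_assoc]
  ring

lemma derivation_half_mul (τ : Derivation k A A) (a : A) :
    τ (half k A * a) = half k A * τ a := by
  simp [half]

end Lemmas

/-- Section 3.5: the gauge-transformation identity
`p₃(ᵍφ) = p₃(φ) + d_Čech p₃(g) + d_DR p₂(φ,g)`, with the de Rham differential
given by the Chevalley–Eilenberg formula. -/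
theorem gauge_p3 {n : ℕ} (hn : 0 < n)
    (φ g h : Matrix (Fin n) (Fin n) A)
    (hφ : IsUnit φ) (hg : IsUnit g) (hh : IsUnit h)
    (τ₀ τ₁ τ₂ : Derivation k A A) :
    p3 k A (g * φ * h⁻¹) τ₀ τ₁ τ₂
      = p3 k A φ τ₀ τ₁ τ₂ + p3 k A g τ₀ τ₁ τ₂ - p3 k A h τ₀ τ₁ τ₂
        + (τ₀ (Qc k A φ g h τ₁ τ₂) - τ₁ (Qc k A φ g h τ₀ τ₂) + τ₂ (Qc k A φ g h τ₀ τ₁)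
          - Qc k A φ g h ⁅τ₀, τ₁⁆ τ₂ + Qc k A φ g h ⁅τ₀, τ₂⁆ τ₁
          - Qc k A φ g h ⁅τ₁, τ₂⁆ τ₀) := by
  have hdQ : τ₀ (Qc k A φ g h τ₁ τ₂) - τ₁ (Qc k A φ g h τ₀ τ₂) + τ₂ (Qc k A φ g h τ₀ τ₁)
      - Qc k A φ g h ⁅τ₀, τ₁⁆ τ₂ + Qc k A φ g h ⁅τ₀, τ₂⁆ τ₁ - Qc k A φ g h ⁅τ₁, τ₂⁆ τ₀ =
      half k A *
        (extDerivTwo (traceWedge (fun ρ => φ⁻¹ * logDerivForm g ρ * φ) (logDerivForm h)) τ₀ τ₁ τ₂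
        + extDerivTwo (traceWedge (logDerivForm φ) (logDerivForm h)) τ₀ τ₁ τ₂
        - extDerivTwo (traceWedge (fun ρ => φ⁻¹ * logDerivForm g ρ * φ) (logDerivForm φ))
            τ₀ τ₁ τ₂) := by
    simp only [Qc_eq hφ, derivation_half_mul, map_add, map_sub, extDerivTwo]
    ring
  have hconj {M : Matrix (Fin n) (Fin n) A} (hM : IsUnit M) (N P R : Matrix (Fin n) (Fin n) A) :
      Matrix.trace (N * P * R) =
        Matrix.trace ((M⁻¹ * N * M) * (M⁻¹ * P * M) * (M⁻¹ * R * M)) := by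
    rw [conj_mul_conj hM, conj_mul_conj hM, trace_conj hM]
  rw [hdQ]
  simp only [p3_eq, extDerivTwo_traceWedge, matrixExtDeriv_conj hφ, matrixExtDeriv_logDerivForm hφ,
    matrixExtDeriv_logDerivForm hg, matrixExtDeriv_logDerivForm hh]
  rw [hconj hh (logDerivForm (g * φ * h⁻¹) τ₀) (logDerivForm (g * φ * h⁻¹) τ₁),
    hconj hh (logDerivForm (g * φ * h⁻¹) τ₀) (logDerivForm (g * φ * h⁻¹) τ₂),
    hconj hφ (logDerivForm g τ₀) (logDerivForm g τ₁),
    hconj hφ (logDerivForm g τ₀) (logDerivForm g τ₂)]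
  simp only [logDerivForm_gauge hφ hg hh, mul_sub φ⁻¹, sub_mul _ _ φ, ← conj_mul_conj hφ]
  generalize φ⁻¹ * logDerivForm g τ₀ * φ = X₀
  generalize φ⁻¹ * logDerivForm g τ₁ * φ = X₁
  generalize φ⁻¹ * logDerivForm g τ₂ * φ = X₂
  generalize logDerivForm φ τ₀ = Y₀
  generalize logDerivForm φ τ₁ = Y₁
  generalize logDerivForm φ τ₂ = Y₂
  generalize logDerivForm h τ₀ = Z₀
  generalize logDerivForm h τ₁ = Z₁
  generalize logDerivForm h τ₂ = Z₂
  have hcycle (N P R : Matrix (Fin n) (Fin n) A) :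
      Matrix.trace (N * P * R) = Matrix.trace (P * R * N) := by
    rw [mul_assoc, Matrix.trace_mul_comm]
  have hcycle' (N P R : Matrix (Fin n) (Fin n) A) :
      Matrix.trace (N * P * R) = Matrix.trace (R * N * P) := Matrix.trace_mul_cycle N P R
  simp only [add_mul, sub_mul, mul_add, mul_sub, ← mul_assoc, Matrix.trace_add, Matrix.trace_sub]
  simp only [hcycle, hcycle']
  ring
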